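/- Let d, n ∈ ℕ be such that 2 ≤ d ≤ 2n. Every assignment f ∈ Fₙ ∩ H(Φₙ, Π_d) satisfies sₙ(f) > n − ⌈d/2⌉, where Φₙ is the separation formula. -/

import Mathlib

/-! Framework for quantified Boolean circuits (QBCs), QU-resolution,
relaxations, and the prover–delayer game, following Chen,
"Proof Complexity Modulo the Polynomial Hierarchy". -/

/-- Quantifiers. -/
inductive Quant where
  | all : Quant
  | ex : Quant
deriving DecidableEq

/-- A partial assignment of Boolean values to (numbered) propositional
variables.  Via the correspondence `C ↔ assign(C)`, partial assignments also
represent clauses (the clause `clause(a)` is the unique clause with variable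
set `dom a` falsified by `a`); we freely identify the two. -/
abbrev PA : Type := ℕ → Option Bool

/-- The everywhere-undefined partial assignment (= the empty clause). -/
def emptyPA : PA := fun _ => none

/-- `g` extends the partial assignment `f`. -/
def ExtendsPA (g f : PA) : Prop := ∀ v b, f v = some b → g v = some b

/-- A total assignment `g` extends a partial assignment `f`; when `f`
represents a clause, this says `g` falsifies that clause. -/
def TotalExtends (g : ℕ → Bool) (f : PA) : Prop := ∀ v b, f v = some b → g v = b

/-- A partial assignment `r` satisfies a clause `C` (i.e. makes some literal
of `C` true). -/
def SatisfiedBy (r : PA) (C : PA) : Prop := ∃ v b, C v = some b ∧ r v = some (!b)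

/-- A quantified Boolean circuit: a quantifier prefix (a list of
quantifier/variable pairs) together with a Boolean function on total
assignments, represented as a predicate. -/
structure QBC where
  pfx : List (Quant × ℕ)
  matrix : (ℕ → Bool) → Prop

/-- The variables of the prefix of a QBC. -/
def QBC.vars (Φ : QBC) : List ℕ := Φ.pfx.map Prod.snd

/-- Well-formedness of a QBC: the prefix has no repeated variables, and the
matrix depends only on the values of the prefix variables. -/
def QBC.WellFormed (Φ : QBC) : Prop :=
  Φ.vars.Nodup ∧
  ∀ f g : ℕ → Bool, (∀ v ∈ Φ.vars, f v = g v) → (Φ.matrix f ↔ Φ.matrix g)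

/-- Standard semantics of a quantifier prefix over a matrix, starting from a
base assignment. -/
def evalQ : List (Quant × ℕ) → ((ℕ → Bool) → Prop) → (ℕ → Bool) → Prop
  | [], φ, g => φ g
  | (Quant.ex, v) :: P, φ, g => ∃ b, evalQ P φ (Function.update g v b)
  | (Quant.all, v) :: P, φ, g => ∀ b, evalQ P φ (Function.update g v b)

/-- Truth of a QBC. -/
def QBC.IsTrue (Φ : QBC) : Prop := ∀ g, evalQ Φ.pfx Φ.matrix g

/-- Falsity of a QBC. -/
def QBC.IsFalse (Φ : QBC) : Prop := ¬ Φ.IsTrue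

/-- The existentially quantified variables of a prefix. -/
def existVars (P : List (Quant × ℕ)) : List ℕ :=
  (P.filter fun p => decide (p.1 = Quant.ex)).map Prod.snd

/-- The universally quantified variables of a prefix. -/
def univVars (P : List (Quant × ℕ)) : List ℕ :=
  (P.filter fun p => decide (p.1 = Quant.all)).map Prod.snd

/-- The relation `u ⪯ v` of a prefix: `vᵢ ⪯ vⱼ` iff `i ≤ j`, or `j < i` and
`Qⱼ = Qⱼ₊₁ = ⋯ = Qᵢ`. -/
def preceq (P : List (Quant × ℕ)) (u v : ℕ) : Prop :=
  ∃ i j : ℕ, (P[i]?).map Prod.snd = some u ∧ (P[j]?).map Prod.snd = some v ∧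
    (i ≤ j ∨ (j < i ∧ ∀ k, j ≤ k → k ≤ i → (P[k]?).map Prod.fst = (P[j]?).map Prod.fst))

/-- `u` strictly precedes `v` (`u ⪯ v` and not `v ⪯ u`). -/
def strictPrec (P : List (Quant × ℕ)) (u v : ℕ) : Prop :=
  preceq P u v ∧ ¬ preceq P v u

/-- dom(f) ⪯ y : every variable on which `f` is defined is `⪯ y`. -/
def domPrec (P : List (Quant × ℕ)) (f : PA) (y : ℕ) : Prop :=
  ∀ u, f u ≠ none → preceq P u y

/-- An ∃-strategy: a family of response functions for the existential
variables, each depending only on the universal variables strictly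
preceding it. -/
def IsExStrategy (Φ : QBC) (σ : ℕ → (ℕ → Bool) → Bool) : Prop :=
  ∀ x ∈ existVars Φ.pfx, ∀ τ τ' : ℕ → Bool,
    (∀ y ∈ univVars Φ.pfx, strictPrec Φ.pfx y x → τ y = τ' y) → σ x τ = σ x τ'

/-- The total assignment `⟨σ, τ⟩` induced by an ∃-strategy `σ` and an
assignment `τ` to the universal variables. -/
def playE (Φ : QBC) (σ : ℕ → (ℕ → Bool) → Bool) (τ : ℕ → Bool) : ℕ → Bool :=
  fun v => if v ∈ existVars Φ.pfx then σ v τ else τ v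

/-- `σ` is a winning ∃-strategy of the prefix of `Φ` for the matrix `M`. -/
def ModelOf (Φ : QBC) (M : (ℕ → Bool) → Prop) (σ : ℕ → (ℕ → Bool) → Bool) : Prop :=
  IsExStrategy Φ σ ∧ ∀ τ : ℕ → Bool, M (playE Φ σ τ)

/-- A model of `Φ` (a winning ∃-strategy). -/
def QBC.Model (Φ : QBC) (σ : ℕ → (ℕ → Bool) → Bool) : Prop :=
  ModelOf Φ Φ.matrix σ

/-- `σ` is a model of `P : C`, where `P` is the prefix of `Φ` and `C` is a
clause (represented by its falsifying assignment). -/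
def ModelOfClause (Φ : QBC) (σ : ℕ → (ℕ → Bool) → Bool) (C : PA) : Prop :=
  ModelOf Φ (fun g => ¬ TotalExtends g C) σ

/-- `C` is an axiom of `Φ`: a clause on the variables of `Φ` such that every
model of `Φ` is a model of `P : C`. -/
def IsAxiom (Φ : QBC) (C : PA) : Prop :=
  (∀ v, C v ≠ none → v ∈ Φ.vars) ∧ ∀ σ, Φ.Model σ → ModelOfClause Φ σ C

/-- An axiom set of `Φ`. -/
def IsAxiomSet (Φ : QBC) (H : Set PA) : Prop := ∀ C ∈ H, IsAxiom Φ C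

/-- A ∀-strategy: response functions for the universal variables, each
depending only on the existential variables strictly preceding it. -/
def IsUnivStrategy (Φ : QBC) (τ : ℕ → (ℕ → Bool) → Bool) : Prop :=
  ∀ y ∈ univVars Φ.pfx, ∀ σ σ' : ℕ → Bool,
    (∀ x ∈ existVars Φ.pfx, strictPrec Φ.pfx x y → σ x = σ' x) → τ y σ = τ y σ'

/-- The total assignment `⟨τ, σ⟩` induced by a ∀-strategy `τ` and an
assignment `σ` to the existential variables. -/
def playU (Φ : QBC) (τ : ℕ → (ℕ → Bool) → Bool) (σ : ℕ → Bool) : ℕ → Bool :=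
  fun v => if v ∈ univVars Φ.pfx then τ v σ else σ v

/-- A winning ∀-strategy: every play falsifies the matrix. -/
def WinningUnivStrategy (Φ : QBC) (τ : ℕ → (ℕ → Bool) → Bool) : Prop :=
  IsUnivStrategy Φ τ ∧ ∀ σ : ℕ → Bool, ¬ Φ.matrix (playU Φ τ σ)

/-- `C` is obtainable from `D` by ∀-elimination (relative to prefix `P`):
`C = D ∖ {L}` for a literal `L` on a universal variable `y` with
`vars(C) ⪯ y`.  In assignment form: `D` is `C` additionally defined on `y`. -/
def ForallElim (P : List (Quant × ℕ)) (C D : PA) : Prop :=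
  ∃ y b, y ∈ univVars P ∧ C y = none ∧ D = Function.update C y (some b) ∧
    ∀ u, C u ≠ none → preceq P u y

/-- `γ` is the resolvent of `α` and `β` on variable `v` (in falsifying
assignment form: `α` and `β` carry complementary literals on `v`, `γ` is
the union of the remainders, which must be a clause). -/
def IsResolvent (γ α β : PA) (v : ℕ) : Prop :=
  ∃ b, α v = some b ∧ β v = some (!b) ∧ γ v = none ∧
    (∀ u, u ≠ v → γ u = (α u).elim (β u) some) ∧
    (∀ u, u ≠ v → ∀ b₁ b₂, α u = some b₁ → β u = some b₂ → b₁ = b₂)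

/-- A step in a QU-resolution proof: an axiom, a ∀-elimination (annotated with
the index of its source), or a resolution step (annotated with the indices of
its two sources and the resolved variable). -/
inductive QUStep where
  | ax (C : PA)
  | elim (C : PA) (src : ℕ)
  | res (C : PA) (src₁ src₂ : ℕ) (v : ℕ)

/-- The clause of a proof step. -/
def QUStep.clause : QUStep → PA
  | .ax C => C
  | .elim C _ => C
  | .res C _ _ _ => C

/-- The clause at position `i` of a proof. -/
def stepClause? (L : List QUStep) (i : ℕ) : Option PA := (L[i]?).map QUStep.clause

/-- Validity of the `i`-th step of a proof from axiom set `H`. -/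
def validStep (P : List (Quant × ℕ)) (H : Set PA) (L : List QUStep) (i : ℕ) : Prop :=
  match L[i]? with
  | none => True
  | some (.ax C) => C ∈ H
  | some (.elim C j) => j < i ∧ ∃ D, stepClause? L j = some D ∧ ForallElim P C D
  | some (.res C j k v) => j < i ∧ k < i ∧
      ∃ α β, stepClause? L j = some α ∧ stepClause? L k = some β ∧ IsResolvent C α β v

/-- A QU-resolution proof of `Φ` from axiom set `H`. -/
def IsQUProof (Φ : QBC) (H : Set PA) (L : List QUStep) : Prop :=
  ∀ i, validStep Φ.pfx H L i

/-- A QU-resolution falsity proof: a proof ending with the empty clause. -/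
def IsFalsityProof (Φ : QBC) (H : Set PA) (L : List QUStep) : Prop :=
  IsQUProof Φ H L ∧ (L.getLast?).map QUStep.clause = some emptyPA

/-- The clause `C` appears in the proof `L`. -/
def AppearsIn (L : List QUStep) (C : PA) : Prop := ∃ i, stepClause? L i = some C

/-- The edge relation of the graph `G(π)`: an edge from each clause occurrence
to the clause occurrence(s) from which it is derived. -/
def edge (L : List QUStep) (i j : ℕ) : Prop :=
  match L[i]? with
  | some (.elim _ s) => j = s
  | some (.res _ s t _) => j = s ∨ j = t
  | _ => False

/-- A sink (leaf) of `G(π)`: a vertex with no outgoing edges. -/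
def isSink (L : List QUStep) (i : ℕ) : Prop := i < L.length ∧ ∀ j, ¬ edge L i j

/-- The proof is tree-like: `G(π)` is a tree (each vertex has at most one
incoming edge; acyclicity holds automatically since edges decrease indices). -/
def TreeLike (L : List QUStep) : Prop := ∀ j : ℕ, {i | edge L i j}.Subsingleton

-- The prefix `P[a]`: the variables of `dom a` are removed, and the
-- quantifier of every variable strictly preceding some variable of `dom a`
-- (equivalently, every `v` with `v ⪯ last(a)` and not `last(a) ⪯ v`) is
-- changed to `∃`.
open Classical in
noncomputable def instPrefix (P : List (Quant × ℕ)) (a : PA) : List (Quant × ℕ) :=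
  (P.filter fun p => (a p.2).isNone).map fun p =>
    (if ∃ u, a u ≠ none ∧ strictPrec P p.2 u then Quant.ex else p.1, p.2)

/-- Overriding a total assignment by a partial assignment. -/
def override (a : PA) (g : ℕ → Bool) : ℕ → Bool := fun v => (a v).getD (g v)

/-- The instantiated QBC `Φ[a]` = `P[a] : φ[a]`. -/
noncomputable def QBC.inst (Φ : QBC) (a : PA) : QBC :=
  ⟨instPrefix Φ.pfx a, fun g => Φ.matrix (override a g)⟩

/-- `P'` is a relaxation of the prefix `P`: a permutation of `P` such that
`y ⪯ x` implies `y ⪯' x` for every universal `y` and existential `x`. -/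
def IsRelaxationPfx (P P' : List (Quant × ℕ)) : Prop :=
  P.Perm P' ∧ ∀ y ∈ univVars P, ∀ x ∈ existVars P, preceq P y x → preceq P' y x

/-- `Φ'` is a relaxation of the QBC `Φ`. -/
def IsRelaxation (Φ Φ' : QBC) : Prop :=
  IsRelaxationPfx Φ.pfx Φ'.pfx ∧ Φ'.matrix = Φ.matrix

/-- Negation of a quantifier. -/
def Quant.neg : Quant → Quant
  | .all => .ex
  | .ex => .all

/-- `isAltFrom q i qs`: the quantifier string `qs` consists of (at most) `i`
alternating possibly-empty blocks, starting with a block of `q`s. -/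
def isAltFrom : Quant → ℕ → List Quant → Prop
  | _, 0, qs => qs = []
  | q, i + 1, qs => ∃ k rest, qs = List.replicate k q ++ rest ∧ isAltFrom q.neg i rest

/-- The prefix `P` is `Π_i`: its quantifier string lies in `∀*∃*∀*⋯` with `i`
alternating starred blocks beginning with `∀*`. -/
def isPiPrefix (i : ℕ) (P : List (Quant × ℕ)) : Prop :=
  isAltFrom Quant.all i (P.map Prod.fst)

/-- The axiom set `H(Φ, Π_k)`: the clauses `C` on variables of `Φ` such that
some `Π_k`-relaxation of `Φ[assign(C)]` is false. -/
def Hset (Φ : QBC) (k : ℕ) : Set PA :=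
  {C | (∀ v, C v ≠ none → v ∈ Φ.vars) ∧
    ∃ Φ' : QBC, IsRelaxation (Φ.inst C) Φ' ∧ isPiPrefix k Φ'.pfx ∧ Φ'.IsFalse}

/-- `g` is a semicompletion of `f` (relative to prefix `P`). -/
def SemiComp (P : List (Quant × ℕ)) (f g : PA) : Prop :=
  ExtendsPA g f ∧
  ∀ y ∈ univVars P, f y = none → domPrec P f y → (g y = none ∧ domPrec P g y)

/-- A set of partial assignments of `Φ` is semicompletion-closed. -/
def SemiCompClosed (Φ : QBC) (H : Set PA) : Prop :=
  ∀ f ∈ H, ∀ g : PA, (∀ v, g v ≠ none → v ∈ Φ.vars) → SemiComp Φ.pfx f g → g ∈ H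

/-- Delayer condition (semicompletion-of-empty). -/
def CondEmpty (Φ : QBC) (F : Set PA) (s : PA → ℕ) : Prop :=
  ∃ g ∈ F, SemiComp Φ.pfx emptyPA g ∧ s g = 0

/-- Delayer condition (monotonicity). -/
def CondMono (Φ : QBC) (F : Set PA) (s : PA → ℕ) : Prop :=
  ∀ g ∈ F, ∀ f' : PA, ExtendsPA g f' → ∃ f ∈ F, SemiComp Φ.pfx f' f ∧ s f ≤ s g

/-- Delayer condition (∀-branching). -/
def CondForallB (Φ : QBC) (F : Set PA) (s : PA → ℕ) : Prop :=
  ∀ f ∈ F, ∀ y ∈ univVars Φ.pfx, f y = none → domPrec Φ.pfx f y →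
    ∀ b : Bool, ∃ g ∈ F, SemiComp Φ.pfx (Function.update f y (some b)) g ∧ s g = s f

/-- Delayer condition (double-branching). -/
def CondDoubleB (Φ : QBC) (F : Set PA) (s : PA → ℕ) : Prop :=
  ∀ f ∈ F, ∀ v ∈ Φ.vars, f v = none →
    ∃ b : Bool, ∃ g ∈ F, SemiComp Φ.pfx (Function.update f v (some b)) g ∧
      s g ≤ s f + 1 ∧
      (s g = s f + 1 →
        ∃ g' ∈ F, SemiComp Φ.pfx (Function.update f v (some (!b))) g' ∧ s g' ≤ s f + 1)

/-- A `p`-point delayer strategy for `Φ` with respect to axiom set `H`. -/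
def IsDelayer (Φ : QBC) (H : Set PA) (p : ℕ) (F : Set PA) (s : PA → ℕ) : Prop :=
  (∀ f ∈ F, ∀ v, f v ≠ none → v ∈ Φ.vars) ∧
  CondEmpty Φ F s ∧ (∀ f ∈ F, f ∈ H → p ≤ s f) ∧
  CondMono Φ F s ∧ CondForallB Φ F s ∧ CondDoubleB Φ F s

/-! The separation formulas `Φₙ` of Section 6. -/

/-- The variable `x_{i,j,k}`. -/
def xV (i : ℕ) (j k : Bool) : ℕ := 9 * i + 2 * cond j 1 0 + cond k 1 0

/-- The variable `x'_{i,j,k}`. -/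
def xV' (i : ℕ) (j k : Bool) : ℕ := 9 * i + 4 + 2 * cond j 1 0 + cond k 1 0

/-- The variable `yᵢ`. -/
def yV (i : ℕ) : ℕ := 9 * i + 8

/-- A block of four quantified variables. -/
def blockOf (q : Quant) (f : Bool → Bool → ℕ) : List (Quant × ℕ) :=
  [(q, f false false), (q, f false true), (q, f true false), (q, f true true)]

/-- The prefix `∃X₀ ∃X'₁∀y₁∃X₁ ⋯ ∃X'ₙ∀yₙ∃Xₙ`. -/
def sepPrefix (n : ℕ) : List (Quant × ℕ) :=
  blockOf Quant.ex (xV 0) ++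
    (List.range n).flatMap fun i =>
      blockOf Quant.ex (xV' (i + 1)) ++ [(Quant.all, yV (i + 1))] ++
        blockOf Quant.ex (xV (i + 1))

/-- The clause `¬x_{0,j,k}` (as its falsifying assignment). -/
def clB1 (j k : Bool) : PA := fun v => if v = xV 0 j k then some true else none

/-- The clause `x_{n,j,0} ∨ x_{n,j,1}`. -/
def clB2 (n : ℕ) (j : Bool) : PA :=
  fun v => if v = xV n j false ∨ v = xV n j true then some false else none

/-- The clause `¬x'_{i,0,k} ∨ ¬x'_{i,1,l} ∨ x_{i−1,j,0} ∨ x_{i−1,j,1}`. -/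
def clH (i : ℕ) (j k l : Bool) : PA := fun v =>
  if v = xV' i false k ∨ v = xV' i true l then some true
  else if v = xV (i - 1) j false ∨ v = xV (i - 1) j true then some false
  else none

/-- For `j = false` the clause `¬x_{i,0,k} ∨ yᵢ ∨ x'_{i,0,k}`; for `j = true`
the clause `¬x_{i,1,k} ∨ ¬yᵢ ∨ x'_{i,1,k}`. -/
def clT (i : ℕ) (j k : Bool) : PA := fun v =>
  if v = xV i j k then some true
  else if v = yV i then some j
  else if v = xV' i j k then some false
  else none

/-- The set `Tᵢ` of clauses. -/
def Tset (i : ℕ) : Set PA := {C | ∃ j k : Bool, C = clT i j k}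

/-- The set of clauses of the matrix `φₙ`. -/
def sepClauses (n : ℕ) : Set PA :=
  {C | (∃ j k : Bool, C = clB1 j k) ∨ (∃ j : Bool, C = clB2 n j) ∨
    (∃ i, 1 ≤ i ∧ i ≤ n ∧ ∃ j k l : Bool, C = clH i j k l) ∨
    (∃ i, 1 ≤ i ∧ i ≤ n ∧ ∃ j k : Bool, C = clT i j k)}

/-- The separation formula `Φₙ`. -/
def sepQBC (n : ℕ) : QBC :=
  ⟨sepPrefix n, fun g => ∀ C ∈ sepClauses n, ¬ TotalExtends g C⟩

/-- The level-`i` variables `X'ᵢ ∪ {yᵢ} ∪ Xᵢ`. -/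
def levelVars (i : ℕ) : List ℕ :=
  [xV' i false false, xV' i false true, xV' i true false, xV' i true true, yV i,
   xV i false false, xV i false true, xV i true false, xV i true true]

/-- `r` is defined exactly on the level-`i` variables. -/
def OnLevel (i : ℕ) (r : PA) : Prop := ∀ v, r v ≠ none ↔ v ∈ levelVars i

/-- A normal realization of level `i`. -/
def NormalReal (i : ℕ) (r : PA) : Prop :=
  OnLevel i r ∧ ∃ b : Bool, r (yV i) = some b ∧
    r (xV i b false) = some false ∧ r (xV' i b false) = some false ∧
    r (xV i b true) = some false ∧ r (xV' i b true) = some false ∧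
    ∃ c : Bool, r (xV i (!b) false) = some c ∧ r (xV' i (!b) false) = some c ∧
      r (xV i (!b) true) = some (!c) ∧ r (xV' i (!b) true) = some (!c)

/-- A funny realization of level `i`. -/
def FunnyReal (i : ℕ) (r : PA) : Prop :=
  OnLevel i r ∧ ∃ b : Bool, r (yV i) = some b ∧
    (∃ c : Bool, r (xV i b false) = some c ∧ r (xV' i b false) = some c ∧
      r (xV i b true) = some (!c) ∧ r (xV' i b true) = some (!c)) ∧
    r (xV' i (!b) false) = some false ∧ r (xV' i (!b) true) = some false ∧
    ∃ d : Bool, r (xV i (!b) false) = some d ∧ r (xV i (!b) true) = some (!d)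

/-- Restriction of a partial assignment to the level-`i` variables. -/
def restrictLevel (i : ℕ) (f : PA) : PA :=
  fun v => if v ∈ levelVars i then f v else none

-- The maximum level `ℓ` containing an existentially quantified variable of
-- `dom f` (and `0` if there is none).
open Classical in
noncomputable def maxLevel (n : ℕ) (f : PA) : ℕ :=
  ((Finset.Icc 1 n).filter fun i => ∃ v ∈ levelVars i, v ≠ yV i ∧ f v ≠ none).sup id

/-- `f` is half-defined on level `ℓ`. -/
def HalfDefined (ℓ : ℕ) (f : PA) : Prop :=
  (∀ j k : Bool, f (xV ℓ j k) = none) ∧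
  (∃ j k : Bool, f (xV' ℓ j k) = some true ∧
    ∀ j' k' : Bool, (j', k') ≠ (j, k) → f (xV' ℓ j' k') = some false)

/-- A normal assignment of `Φₙ`. -/
def NormalAssign (n : ℕ) (f : PA) : Prop :=
  (∀ v, f v ≠ none → v ∈ (sepPrefix n).map Prod.snd) ∧
  (∀ j k : Bool, f (xV 0 j k) = some false) ∧
  (∀ i, 1 ≤ i → i + 1 ≤ maxLevel n f → NormalReal i (restrictLevel i f)) ∧
  (1 ≤ maxLevel n f →
    (NormalReal (maxLevel n f) (restrictLevel (maxLevel n f) f) ∨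
      HalfDefined (maxLevel n f) f))

/-- A funny assignment of `Φₙ`, with witness `m` (so that `sₙ(f) = m`). -/
def FunnyAssign (n : ℕ) (f : PA) (m : ℕ) : Prop :=
  (∀ v, f v ≠ none → v ∈ (sepPrefix n).map Prod.snd) ∧
  1 ≤ m ∧ m ≤ maxLevel n f ∧
  (∀ j k : Bool, f (xV 0 j k) = some false) ∧
  (∀ i, 1 ≤ i → i < m → NormalReal i (restrictLevel i f)) ∧
  FunnyReal m (restrictLevel m f) ∧
  (∀ i, m < i → i ≤ maxLevel n f → ∀ j : Bool,
    ((f (xV i j false) ≠ none ∨ f (xV i j true) ≠ none ∨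
      f (xV' i j false) ≠ none ∨ f (xV' i j true) ≠ none) →
      ∃ c : Bool, f (xV i j false) = some c ∧ f (xV' i j false) = some c ∧
        f (xV i j true) = some (!c) ∧ f (xV' i j true) = some (!c)))

/-- The set `Fₙ` of normal and funny assignments. -/
def Fset (n : ℕ) : Set PA := {f | NormalAssign n f ∨ ∃ m, FunnyAssign n f m}

-- The score function `sₙ`.
open Classical in
noncomputable def score (n : ℕ) (f : PA) : ℕ :=
  if h : ∃ m, FunnyAssign n f m then h.choose else maxLevel n f

/-! The mod-3 formulas `Ψₙ` of Section 7 (variables `xᵢ = 2i`, `yᵢ = 2i+1`). -/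

/-- The prefix `∃x₁∀y₁⋯∃xₙ∀yₙ`. -/
def modPrefix (n : ℕ) : List (Quant × ℕ) :=
  (List.range n).flatMap fun i =>
    [(Quant.ex, 2 * (i + 1)), (Quant.all, 2 * (i + 1) + 1)]

/-- Numeric value of a Boolean. -/
def boolVal (b : Bool) : ℕ := cond b 1 0

/-- The matrix `φ_{n,j}`: true iff `j + Σᵢ (xᵢ + yᵢ) ≢ n (mod 3)`. -/
def modMatrix (n j : ℕ) (g : ℕ → Bool) : Prop :=
  ¬ ((j + ∑ i ∈ Finset.Icc 1 n, (boolVal (g (2 * i)) + boolVal (g (2 * i + 1)))) % 3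
      = n % 3)

/-- The mod-3 formula `Ψₙ`. -/
def modQBC (n : ℕ) : QBC := ⟨modPrefix n, modMatrix n 0⟩

/-! ### Helper lemmas for the proof of Lemma 6.5 -/

/-- A strategy whose response at each existential variable depends only on
variables occurring earlier yields truth of the quantified formula. -/
theorem evalQ_of_strategy (σ : ℕ → (ℕ → Bool) → Bool) (φ : (ℕ → Bool) → Prop) :
    ∀ (P : List (Quant × ℕ)) (g : ℕ → Bool), (P.map Prod.snd).Nodup →
      (∀ A v B, P = A ++ (Quant.ex, v) :: B → ∀ h h' : ℕ → Bool,
        (∀ u, u ≠ v → u ∉ B.map Prod.snd → h u = h' u) → σ v h = σ v h') →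
      (∀ h : ℕ → Bool, (∀ v, (Quant.ex, v) ∈ P → h v = σ v h) →
        (∀ v, v ∉ P.map Prod.snd → h v = g v) → φ h) →
      evalQ P φ g := by
  intro P
  induction P with
  | nil =>
    intro g _ _ hφ
    exact hφ g (by simp) (by simp)
  | cons p P ih =>
    obtain ⟨q, w⟩ := p
    intro g hnd hdep hφ
    simp only [List.map_cons, List.nodup_cons] at hnd
    have hdep' : ∀ A v B, P = A ++ (Quant.ex, v) :: B → ∀ h h' : ℕ → Bool,
        (∀ u, u ≠ v → u ∉ B.map Prod.snd → h u = h' u) → σ v h = σ v h' := by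
      intro A v B hP
      exact hdep ((q, w) :: A) v B (by simp [hP])
    cases q with
    | ex =>
      refine ⟨σ w g, ih _ hnd.2 hdep' ?_⟩
      intro h h1 h2
      have hw : h w = σ w g := by
        rw [h2 w hnd.1]; simp
      have hag : ∀ v, v ≠ w → v ∉ P.map Prod.snd → h v = g v := by
        intro v hv hvP
        rw [h2 v hvP]; simp [hv]
      apply hφ
      · intro v hv
        rcases List.mem_cons.1 hv with hv | hv
        · have : v = w := by simpa using hv
          subst this
          rw [hw]
          exact (hdep [] v P rfl h g hag).symm
        · exact h1 v hv
      · intro v hv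
        simp only [List.map_cons, List.mem_cons, not_or] at hv
        exact hag v hv.1 hv.2
    | all =>
      intro b
      refine ih _ hnd.2 hdep' ?_
      intro h h1 h2
      apply hφ
      · intro v hv
        rcases List.mem_cons.1 hv with hv | hv
        · simp at hv
        · exact h1 v hv
      · intro v hv
        simp only [List.map_cons, List.mem_cons, not_or] at hv
        rw [h2 v hv.2]; simp [hv.1]

/-- The block-number function of an alternating quantifier string. -/
theorem exists_blockNumber : ∀ (d : ℕ) (q : Quant) (L : List Quant), isAltFrom q d L →
    ∃ β : ℕ → ℕ, Monotone β ∧ ∀ k a, L[k]? = some a → β k < d ∧ (β k % 2 = 0 ↔ a = q) := by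
  intro d
  induction d with
  | zero =>
    intro q L h
    simp only [isAltFrom] at h
    subst h
    exact ⟨fun _ => 0, fun _ _ _ => le_rfl, by simp⟩
  | succ d ih =>
    intro q L h
    obtain ⟨m, rest, rfl, hr⟩ := h
    obtain ⟨β, hm, hβ⟩ := ih _ _ hr
    refine ⟨fun k => if k < m then 0 else β (k - m) + 1, ?_, ?_⟩
    · intro a b hab
      dsimp only
      split_ifs with h1 h2
      · exact le_rfl
      · omega
      · omega
      · have := hm (show a - m ≤ b - m by omega)
        omega
    · intro k a hk
      dsimp only
      by_cases hkm : k < m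
      · rw [List.getElem?_append_left (by simpa using hkm)] at hk
        simp only [hkm, if_true]
        rw [List.getElem?_replicate] at hk
        simp only [hkm, if_true, Option.some.injEq] at hk
        simp [hk]
      · rw [List.getElem?_append_right (by simpa using hkm)] at hk
        simp only [List.length_replicate] at hk
        simp only [hkm, if_false]
        obtain ⟨h1, h2⟩ := hβ _ _ hk
        refine ⟨by omega, ?_⟩
        have h3 : (β (k - m) + 1) % 2 = 0 ↔ ¬ (β (k - m) % 2 = 0) := by omega
        rw [h3, h2]
        cases a <;> cases q <;> simp [Quant.neg]

theorem preceq_of_sublist {P : List (Quant × ℕ)} {u v : ℕ}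
    (h : [u, v].Sublist (P.map Prod.snd)) : preceq P u v := by
  obtain ⟨f, hf⟩ := List.sublist_iff_exists_orderEmbedding_getElem?_eq.1 h
  refine ⟨f 0, f 1, ?_, ?_, Or.inl ?_⟩
  · have := hf 0
    simpa using this.symm
  · have := hf 1
    simpa using this.symm
  · exact f.monotone (by omega)

/-- Indices of occurrences of a variable are unique. -/
theorem index_unique {P : List (Quant × ℕ)} (hnd : (P.map Prod.snd).Nodup) {i j : ℕ} {v : ℕ}
    (hi : (P[i]?).map Prod.snd = some v) (hj : (P[j]?).map Prod.snd = some v) : i = j := by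
  rw [← List.getElem?_map] at hi hj
  have hil : i < (P.map Prod.snd).length := by
    by_contra hc
    rw [List.getElem?_eq_none (by omega)] at hi
    simp at hi
  exact (List.getElem?_inj hil hnd).1 (hi.trans hj.symm)

/-- A universal variable `⪯` an existential one has smaller index. -/
theorem index_lt_of_preceq {P : List (Quant × ℕ)} (hnd : (P.map Prod.snd).Nodup) {a b y x : ℕ}
    (ha : P[a]? = some (Quant.all, y)) (hb : P[b]? = some (Quant.ex, x))
    (h : preceq P y x) : a < b := by
  obtain ⟨i, j, hi, hj, hij⟩ := h
  have e1 : i = a := index_unique hnd hi (by simp [ha])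
  have e2 : j = b := index_unique hnd hj (by simp [hb])
  subst e1 e2
  rcases hij with hij | ⟨hij, hk⟩
  · rcases Nat.lt_or_ge i j with h | h
    · exact h
    · have : i = j := by omega
      subst this
      rw [ha] at hb
      simp at hb
  · have := hk i (by omega) le_rfl
    rw [ha, hb] at this
    simp at this

theorem index_lt_of_not_preceq {P : List (Quant × ℕ)} {a b y x : ℕ} {q q' : Quant}
    (ha : P[a]? = some (q, y)) (hb : P[b]? = some (q', x))
    (h : ¬ preceq P y x) : b < a := by
  by_contra hc
  exact h ⟨a, b, by simp [ha], by simp [hb], Or.inl (by omega)⟩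

/-! Facts about the prefix of the separation formula. -/

theorem sepPrefix_succ (n : ℕ) : sepPrefix (n + 1) = sepPrefix n ++
    (blockOf Quant.ex (xV' (n + 1)) ++ [(Quant.all, yV (n + 1))] ++
        blockOf Quant.ex (xV (n + 1))) := by
  simp [sepPrefix, List.range_succ]

theorem sepPrefix_lt (n : ℕ) : ∀ v ∈ (sepPrefix n).map Prod.snd, v < 9 * n + 9 := by
  induction n with
  | zero => simp [sepPrefix, blockOf, xV]
  | succ n ih =>
    intro v hv
    rw [sepPrefix_succ, List.map_append, List.mem_append] at hv
    rcases hv with hv | hv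
    · have := ih v hv
      omega
    · simp [blockOf, xV, xV', yV] at hv
      omega

theorem sepPrefix_nodup (n : ℕ) : ((sepPrefix n).map Prod.snd).Nodup := by
  induction n with
  | zero => simp [sepPrefix, blockOf, xV]
  | succ n ih =>
    rw [sepPrefix_succ, List.map_append, List.nodup_append]
    refine ⟨ih, ?_, ?_⟩
    · simp [blockOf, xV, xV', yV]
      omega
    · intro a ha b hb
      have := sepPrefix_lt n a ha
      simp [blockOf, xV, xV', yV] at hb
      omega

theorem mem_sep_x0 (n : ℕ) (j k : Bool) : (Quant.ex, xV 0 j k) ∈ sepPrefix n := by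
  cases j <;> cases k <;> simp [sepPrefix, blockOf]

theorem mem_sep_x (n i : ℕ) (h2 : i ≤ n) (j k : Bool) :
    (Quant.ex, xV i j k) ∈ sepPrefix n := by
  induction n with
  | zero =>
    obtain rfl : i = 0 := by omega
    exact mem_sep_x0 _ _ _
  | succ n ih =>
    rw [sepPrefix_succ, List.mem_append]
    rcases Nat.lt_or_ge n i with h | h
    · obtain rfl : i = n + 1 := by omega
      right
      cases j <;> cases k <;> simp [blockOf]
    · exact Or.inl (ih h)

theorem mem_sep_x' (n i : ℕ) (h1 : 1 ≤ i) (h2 : i ≤ n) (j k : Bool) :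
    (Quant.ex, xV' i j k) ∈ sepPrefix n := by
  induction n with
  | zero => omega
  | succ n ih =>
    rw [sepPrefix_succ, List.mem_append]
    rcases Nat.lt_or_ge n i with h | h
    · obtain rfl : i = n + 1 := by omega
      right
      cases j <;> cases k <;> simp [blockOf]
    · exact Or.inl (ih h)

theorem mem_sep_y (n i : ℕ) (h1 : 1 ≤ i) (h2 : i ≤ n) :
    (Quant.all, yV i) ∈ sepPrefix n := by
  induction n with
  | zero => omega
  | succ n ih =>
    rw [sepPrefix_succ, List.mem_append]
    rcases Nat.lt_or_ge n i with h | h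
    · obtain rfl : i = n + 1 := by omega
      right
      simp
    · exact Or.inl (ih h)

theorem sublist_sep (n i : ℕ) (h1 : 1 ≤ i) (h2 : i + 1 ≤ n) (j k : Bool) :
    [yV i, xV' (i + 1) j k].Sublist ((sepPrefix n).map Prod.snd) := by
  induction n with
  | zero => omega
  | succ n ih =>
    rw [sepPrefix_succ, List.map_append]
    rcases Nat.lt_or_ge n (i + 1) with h | h
    · obtain rfl : i = n := by omega
      have e : [yV i, xV' (i + 1) j k] = [yV i] ++ [xV' (i + 1) j k] := rfl
      rw [e]
      apply List.Sublist.append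
      · rw [List.singleton_sublist]
        exact List.mem_map.2 ⟨_, mem_sep_y i i h1 le_rfl, rfl⟩
      · rw [List.singleton_sublist]
        cases j <;> cases k <;> simp [blockOf]
    · exact (ih h).trans (List.sublist_append_left _ _)

/-! Facts about instantiated prefixes. -/

theorem instPrefix_vars (P : List (Quant × ℕ)) (f : PA) :
    (instPrefix P f).map Prod.snd = (P.map Prod.snd).filter fun v => (f v).isNone := by
  unfold instPrefix
  rw [List.map_map, List.filter_map]
  rfl

theorem mem_inst_ex {P : List (Quant × ℕ)} {f : PA} {v : ℕ} (h : (Quant.ex, v) ∈ P)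
    (hf : f v = none) : (Quant.ex, v) ∈ instPrefix P f := by
  unfold instPrefix
  refine List.mem_map.2 ⟨(Quant.ex, v), List.mem_filter.2 ⟨h, by simp [hf]⟩, ?_⟩
  simp

theorem mem_inst_or {P : List (Quant × ℕ)} {f : PA} {q : Quant} {v : ℕ} (h : (q, v) ∈ P)
    (hf : f v = none) : (Quant.all, v) ∈ instPrefix P f ∨ (Quant.ex, v) ∈ instPrefix P f := by
  have : v ∈ (instPrefix P f).map Prod.snd := by
    rw [instPrefix_vars, List.mem_filter]
    exact ⟨List.mem_map.2 ⟨_, h, rfl⟩, by simp [hf]⟩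
  obtain ⟨⟨q', v'⟩, hm, rfl⟩ := List.mem_map.1 this
  cases q'
  · exact Or.inl hm
  · exact Or.inr hm

theorem mem_inst_none {P : List (Quant × ℕ)} {f : PA} {q : Quant} {v : ℕ}
    (h : (q, v) ∈ instPrefix P f) : f v = none := by
  have : v ∈ (instPrefix P f).map Prod.snd := List.mem_map.2 ⟨_, h, rfl⟩
  rw [instPrefix_vars, List.mem_filter] at this
  simpa using this.2

/-- Sufficient conditions for the matrix of the separation formula. -/
theorem sep_matrix (n : ℕ) (G : ℕ → Bool)
    (hB1 : ∀ j k, G (xV 0 j k) = false)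
    (hB2 : ∀ j, ∃ k, G (xV n j k) = true)
    (hH : ∀ i j, 1 ≤ i → i ≤ n →
      (∃ c, ∀ k, G (xV' i c k) = false) ∨ ∃ k, G (xV (i - 1) j k) = true)
    (hT : ∀ i j k, 1 ≤ i → i ≤ n → G (xV i j k) = true → G (yV i) = j →
      G (xV' i j k) = true) :
    (sepQBC n).matrix G := by
  intro C hC hG
  rcases hC with ⟨j, k, rfl⟩ | ⟨j, rfl⟩ | ⟨i, h1, h2, j, k, l, rfl⟩ | ⟨i, h1, h2, j, k, rfl⟩
  · have := hG (xV 0 j k) true (by simp [clB1])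
    rw [hB1] at this
    simp at this
  · obtain ⟨k, hk⟩ := hB2 j
    have := hG (xV n j k) false (by cases k <;> simp [clB2])
    rw [hk] at this
    simp at this
  · rcases hH i j h1 h2 with ⟨c, hc⟩ | ⟨m, hm⟩
    · cases c
      · have := hG (xV' i false k) true (by simp [clH])
        rw [hc] at this
        simp at this
      · have := hG (xV' i true l) true (by simp [clH])
        rw [hc] at this
        simp at this
    · have := hG (xV (i - 1) j m) false (by
        have h3 : ∀ a b, xV (i - 1) j m ≠ xV' i a b := by
          intro a b
          cases j <;> cases m <;> cases a <;> cases b <;> simp [xV, xV'] <;> omega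
        cases m <;> simp [clH, h3])
      rw [hm] at this
      simp at this
  · have e1 : yV i ≠ xV i j k := by
      cases j <;> cases k <;> simp [xV, yV]
    have e2 : xV' i j k ≠ xV i j k := by
      cases j <;> cases k <;> simp [xV, xV']
    have e3 : xV' i j k ≠ yV i := by
      cases j <;> cases k <;> simp [yV, xV']
    have a1 := hG (xV i j k) true (by simp [clT])
    have a2 := hG (yV i) j (by simp [clT, e1])
    have a3 := hG (xV' i j k) false (by simp [clT, e2, e3])
    rw [hT i j k h1 h2 a1 a2] at a3
    simp at a3

/-- Variables above the maximum level are undefined. -/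
theorem undef_above {n : ℕ} {f : PA} {i : ℕ} (h1 : maxLevel n f < i) (h2 : i ≤ n) (j k : Bool) :
    f (xV i j k) = none ∧ f (xV' i j k) = none := by
  classical
  have key : ∀ v ∈ levelVars i, v ≠ yV i → f v = none := by
    intro v hv hy
    by_contra hc
    have hm : i ∈ (Finset.Icc 1 n).filter
        (fun i => ∃ v ∈ levelVars i, v ≠ yV i ∧ f v ≠ none) := by
      rw [Finset.mem_filter, Finset.mem_Icc]
      exact ⟨⟨by omega, h2⟩, v, hv, hy, hc⟩
    have hle : i ≤ maxLevel n f := by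
      unfold maxLevel
      exact Finset.le_sup (f := id) hm
    omega
  constructor
  · apply key
    · cases j <;> cases k <;> simp [levelVars]
    · cases j <;> cases k <;> simp [xV, yV]
  · apply key
    · cases j <;> cases k <;> simp [levelVars]
    · cases j <;> cases k <;> simp [xV', yV]

theorem maxLevel_le (n : ℕ) (f : PA) : maxLevel n f ≤ n := by
  classical
  unfold maxLevel
  apply Finset.sup_le
  intro b hb
  exact (Finset.mem_Icc.1 (Finset.mem_filter.1 hb).1).2

theorem restrict_x (i : ℕ) (f : PA) (j k : Bool) : restrictLevel i f (xV i j k) = f (xV i j k) := by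
  have : xV i j k ∈ levelVars i := by cases j <;> cases k <;> simp [levelVars]
  simp [restrictLevel, this]

theorem restrict_x' (i : ℕ) (f : PA) (j k : Bool) :
    restrictLevel i f (xV' i j k) = f (xV' i j k) := by
  have : xV' i j k ∈ levelVars i := by cases j <;> cases k <;> simp [levelVars]
  simp [restrictLevel, this]

theorem restrict_y (i : ℕ) (f : PA) : restrictLevel i f (yV i) = f (yV i) := by
  have : yV i ∈ levelVars i := by simp [levelVars]
  simp [restrictLevel, this]

theorem normalReal_facts {i : ℕ} {f : PA} (h : NormalReal i (restrictLevel i f)) :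
    (∃ c, ∀ k, f (xV' i c k) = some false) ∧
      ∀ j k, ∃ b, f (xV i j k) = some b ∧ f (xV' i j k) = some b := by
  obtain ⟨-, b, -, h1, h2, h3, h4, c, h5, h6, h7, h8⟩ := h
  simp only [restrict_x, restrict_x'] at h1 h2 h3 h4 h5 h6 h7 h8
  refine ⟨⟨b, by intro k; cases k <;> assumption⟩, ?_⟩
  intro j k
  have hj : j = b ∨ j = !b := by cases j <;> cases b <;> simp
  rcases hj with rfl | rfl <;> cases k
  · exact ⟨_, h1, h2⟩
  · exact ⟨_, h3, h4⟩
  · exact ⟨_, h5, h6⟩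
  · exact ⟨_, h7, h8⟩

theorem halfDefined_facts {i : ℕ} {f : PA} (h : HalfDefined i f) :
    (∃ c, ∀ k, f (xV' i c k) = some false) ∧ ∀ j k, f (xV i j k) = none := by
  obtain ⟨h1, j, k, -, h2⟩ := h
  refine ⟨⟨!j, fun k' => h2 _ _ ?_⟩, h1⟩
  simp

theorem override_some {f : PA} {v : ℕ} {b : Bool} (h : ℕ → Bool) (hf : f v = some b) :
    override f h v = b := by simp [override, hf]

theorem override_none {f : PA} {v : ℕ} (h : ℕ → Bool) (hf : f v = none) :
    override f h v = h v := by simp [override, hf]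

/-- The constant strategy setting `x_{i,j,k}` and `x'_{i,j,k}` to `k`. -/
def kStrat (v : ℕ) : Bool := decide ((v % 9) % 2 = 1)

theorem kStrat_x (i : ℕ) (j k : Bool) : kStrat (xV i j k) = k := by
  cases j <;> cases k <;> simp [kStrat, xV] <;> omega

theorem kStrat_x' (i : ℕ) (j k : Bool) : kStrat (xV' i j k) = k := by
  cases j <;> cases k <;> simp [kStrat, xV'] <;> omega

/-- The strategy that plays `0` below level `i`, a funny realization at level
`i` (with `Y` the known value of `yᵢ`), and `k` above. -/
def sStrat (i : ℕ) (Y : (ℕ → Bool) → Bool) (v : ℕ) (h : ℕ → Bool) : Bool :=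
  if v % 9 < 4 then decide (i ≤ v / 9) && kStrat v
  else if v % 9 = 8 then false
  else if i < v / 9 then kStrat v
  else if v / 9 = i then (decide (6 ≤ v % 9) == Y h) && kStrat v
  else false

theorem xV_mod (t : ℕ) (j k : Bool) : xV t j k % 9 < 4 ∧ xV t j k / 9 = t := by
  cases j <;> cases k <;> simp [xV] <;> omega

theorem xV'_mod (t : ℕ) (j k : Bool) :
    ¬ xV' t j k % 9 < 4 ∧ ¬ xV' t j k % 9 = 8 ∧ xV' t j k / 9 = t ∧
      decide (6 ≤ xV' t j k % 9) = j := by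
  cases j <;> cases k <;> simp [xV'] <;> omega

theorem sStrat_x (i t : ℕ) (Y) (h) (j k : Bool) :
    sStrat i Y (xV t j k) h = (decide (i ≤ t) && k) := by
  simp [sStrat, xV_mod, kStrat_x]

theorem sStrat_x' (i t : ℕ) (Y) (h) (j k : Bool) :
    sStrat i Y (xV' t j k) h =
      if i < t then k else if t = i then (j == Y h) && k else false := by
  obtain ⟨h1, h2, h3, h4⟩ := xV'_mod t j k
  simp only [sStrat, h1, h2, h3, h4, kStrat_x', if_false]

theorem sStrat_y (i t : ℕ) (Y) (h) : sStrat i Y (yV t) h = false := by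
  have h2 : yV t % 9 = 8 := by simp [yV]
  simp [sStrat, h2]

/-- Every relaxation of an instantiation by a funny assignment is true. -/
theorem funny_true {n m : ℕ} {f : PA} (hf : FunnyAssign n f m) (P' : List (Quant × ℕ))
    (hperm : (instPrefix (sepPrefix n) f).Perm P') (hnd : (P'.map Prod.snd).Nodup)
    (g : ℕ → Bool) :
    evalQ P' (fun g => (sepQBC n).matrix (override f g)) g := by
  obtain ⟨-, hm1, hmL, h0, hnorm, hfun, hab⟩ := hf
  have hLn := maxLevel_le n f
  obtain ⟨-, b, hy, ⟨c, hb1, hb2, hb3, hb4⟩, hb5, hb6, d, hb7, hb8⟩ := hfun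
  simp only [restrict_x, restrict_x', restrict_y] at hy hb1 hb2 hb3 hb4 hb5 hb6 hb7 hb8
  apply evalQ_of_strategy (fun v _ => kStrat v) _ P' g hnd
  · intros; rfl
  · intro h hex _
    have hx : ∀ t j k, t ≤ n → f (xV t j k) = none → h (xV t j k) = k := by
      intro t j k htn hfn
      rw [hex _ (hperm.mem_iff.1 (mem_inst_ex (mem_sep_x n t htn j k) hfn)), kStrat_x]
    have hx' : ∀ t j k, 1 ≤ t → t ≤ n → f (xV' t j k) = none → h (xV' t j k) = k := by
      intro t j k ht htn hfn
      rw [hex _ (hperm.mem_iff.1 (mem_inst_ex (mem_sep_x' n t ht htn j k) hfn)), kStrat_x']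
    have habove : ∀ t, m < t → t ≤ n → ∀ j, (∃ k, override f h (xV t j k) = true) ∧
        ∀ k, override f h (xV t j k) = override f h (xV' t j k) := by
      intro t ht htn j
      by_cases hdef : t ≤ maxLevel n f ∧ (f (xV t j false) ≠ none ∨ f (xV t j true) ≠ none ∨
          f (xV' t j false) ≠ none ∨ f (xV' t j true) ≠ none)
      · obtain ⟨e, h1, h2, h3, h4⟩ := hab t ht hdef.1 j hdef.2
        constructor
        · cases e
          · exact ⟨true, override_some h h3⟩
          · exact ⟨false, override_some h h1⟩
        · intro k
          cases k
          · rw [override_some h h1, override_some h h2]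
          · rw [override_some h h3, override_some h h4]
      · have hun : ∀ k, f (xV t j k) = none ∧ f (xV' t j k) = none := by
          intro k
          by_cases hL : t ≤ maxLevel n f
          · have h3 : ¬ (f (xV t j false) ≠ none ∨ f (xV t j true) ≠ none ∨
              f (xV' t j false) ≠ none ∨ f (xV' t j true) ≠ none) := fun h4 => hdef ⟨hL, h4⟩
            push Not at h3
            cases k
            · exact ⟨h3.1, h3.2.2.1⟩
            · exact ⟨h3.2.1, h3.2.2.2⟩
          · exact undef_above (by omega) htn j k
        have hk : ∀ k, override f h (xV t j k) = k := fun k => by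
          rw [override_none h (hun k).1, hx t j k htn (hun k).1]
        refine ⟨⟨true, hk true⟩, fun k => ?_⟩
        rw [hk, override_none h (hun k).2, hx' t j k (by omega) htn (hun k).2]
    have hbj : ∀ j, j = b ∨ j = !b := by intro j; cases j <;> cases b <;> simp
    have hone : ∀ t, m ≤ t → t ≤ n → ∀ j, ∃ k, override f h (xV t j k) = true := by
      intro t ht htn j
      rcases Nat.lt_or_ge m t with h1 | h1
      · exact (habove t h1 htn j).1
      · obtain rfl : t = m := by omega
        rcases hbj j with rfl | rfl
        · cases c
          · exact ⟨true, override_some h hb3⟩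
          · exact ⟨false, override_some h hb1⟩
        · cases d
          · exact ⟨true, override_some h hb8⟩
          · exact ⟨false, override_some h hb7⟩
    apply sep_matrix
    · intro j k
      exact override_some h (h0 j k)
    · exact hone n (by omega) le_rfl
    · intro t j ht htn
      rcases lt_trichotomy t m with h1 | h1 | h1
      · left
        obtain ⟨⟨c, hc⟩, -⟩ := normalReal_facts (hnorm t ht h1)
        exact ⟨c, fun k => override_some h (hc k)⟩
      · left
        subst h1
        exact ⟨!b, fun k => override_some h (by cases k <;> assumption)⟩
      · right
        exact hone (t - 1) (by omega) (by omega) j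
    · intro t j k ht htn hxt hyt
      rcases lt_trichotomy t m with h1 | h1 | h1
      · obtain ⟨-, hc⟩ := normalReal_facts (hnorm t ht h1)
        obtain ⟨e, he1, he2⟩ := hc j k
        rw [override_some h he1] at hxt
        rw [override_some h he2, hxt]
      · subst h1
        rw [override_some h hy] at hyt
        subst hyt
        cases k
        · rw [override_some h hb1] at hxt
          rw [override_some h hb2, hxt]
        · rw [override_some h hb3] at hxt
          rw [override_some h hb4, hxt]
      · rw [← (habove t h1 htn j).2 k, hxt]

/-- If some level above the maximum level is known, a relaxation of an
instantiation by a normal assignment is true. -/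
theorem normal_true {n i : ℕ} {f : PA} (hf : NormalAssign n f) (P' : List (Quant × ℕ))
    (hperm : (instPrefix (sepPrefix n) f).Perm P') (hnd : (P'.map Prod.snd).Nodup)
    (hi1 : maxLevel n f < i) (hi2 : i ≤ n)
    (hknown : (Quant.all, yV i) ∈ P' → ∀ j k, preceq P' (yV i) (xV' i j k))
    (g : ℕ → Bool) :
    evalQ P' (fun g => (sepQBC n).matrix (override f g)) g := by
  classical
  obtain ⟨-, h0, hnorm, htop⟩ := hf
  set Y : (ℕ → Bool) → Bool := fun h =>
    if (Quant.all, yV i) ∈ P' then h (yV i) else (f (yV i)).getD false with hY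
  apply evalQ_of_strategy (sStrat i Y) _ P' g hnd
  · intro A v B hP h h' hag
    have hYe : v / 9 = i → 4 ≤ v % 9 → v % 9 < 8 → Y h = Y h' := by
      intro hv h4 h8
      by_cases hyP : (Quant.all, yV i) ∈ P'
      · have : ∃ j k, v = xV' i j k := by
          have h5 : v % 9 = 4 ∨ v % 9 = 5 ∨ v % 9 = 6 ∨ v % 9 = 7 := by omega
          rcases h5 with h5 | h5 | h5 | h5
          · exact ⟨false, false, by simp [xV']; omega⟩
          · exact ⟨false, true, by simp [xV']; omega⟩
          · exact ⟨true, false, by simp [xV']; omega⟩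
          · exact ⟨true, true, by simp [xV']; omega⟩
        obtain ⟨j, k, rfl⟩ := this
        have hp := hknown hyP j k
        obtain ⟨a, ha⟩ := List.mem_iff_getElem?.1 hyP
        have hb : P'[A.length]? = some (Quant.ex, xV' i j k) := by simp [hP]
        have hlt := index_lt_of_preceq hnd ha hb hp
        simp only [hY, hyP, if_true]
        apply hag
        · intro he
          rw [he] at ha
          have := index_unique hnd (v := xV' i j k) (i := a) (j := A.length)
            (by simp [ha]) (by simp [hb])
          omega
        · intro hB
          obtain ⟨⟨q, w⟩, hw, hwe⟩ := List.mem_map.1 hB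
          simp only at hwe
          subst hwe
          obtain ⟨e, he⟩ := List.mem_iff_getElem?.1 hw
          have h6 : P'[A.length + 1 + e]? = some (q, yV i) := by
            rw [hP, List.getElem?_append_right (by omega)]
            rw [show A.length + 1 + e - A.length = e + 1 by omega]
            simpa using he
          have := index_unique hnd (v := yV i) (i := a) (j := A.length + 1 + e)
            (by simp [ha]) (by simp [h6])
          omega
      · simp [hY, hyP]
    unfold sStrat
    split_ifs with h1 h2 h3 h4
    · rfl
    · rfl
    · rfl
    · rw [hYe h4 (by omega) (by omega)]
    · rfl
  · intro h hex _
    have hx : ∀ t j k, t ≤ n → f (xV t j k) = none →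
        override f h (xV t j k) = (decide (i ≤ t) && k) := by
      intro t j k htn hfn
      rw [override_none h hfn,
        hex _ (hperm.mem_iff.1 (mem_inst_ex (mem_sep_x n t htn j k) hfn)), sStrat_x]
    have hx' : ∀ t j k, 1 ≤ t → t ≤ n → f (xV' t j k) = none → override f h (xV' t j k) =
        if i < t then k else if t = i then (j == Y h) && k else false := by
      intro t j k ht htn hfn
      rw [override_none h hfn,
        hex _ (hperm.mem_iff.1 (mem_inst_ex (mem_sep_x' n t ht htn j k) hfn)), sStrat_x']
    have hyi : override f h (yV i) = Y h := by
      by_cases hyP : (Quant.all, yV i) ∈ P'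
      · simp only [hY, hyP, if_true]
        exact override_none h (mem_inst_none (hperm.mem_iff.2 hyP))
      · simp only [hY, hyP, if_false]
        rcases hfy : f (yV i) with _ | b
        · rw [override_none h hfy]
          rcases mem_inst_or (mem_sep_y n i (by omega) hi2) hfy with h1 | h1
          · exact absurd (hperm.mem_iff.1 h1) hyP
          · rw [hex _ (hperm.mem_iff.1 h1), sStrat_y]
            rfl
        · rw [override_some h hfy]
          rfl
    have hlow : ∀ t, 1 ≤ t → t ≤ maxLevel n f → (∃ c, ∀ k, f (xV' t c k) = some false) ∧
        ∀ j k, (∃ b, f (xV t j k) = some b ∧ f (xV' t j k) = some b) ∨ f (xV t j k) = none := by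
      intro t ht htL
      by_cases hL : t + 1 ≤ maxLevel n f
      · obtain ⟨h1, h2⟩ := normalReal_facts (hnorm t ht hL)
        exact ⟨h1, fun j k => Or.inl (h2 j k)⟩
      · have hte : t = maxLevel n f := by omega
        rw [hte]
        rcases htop (by omega) with h1 | h1
        · obtain ⟨h1, h2⟩ := normalReal_facts h1
          exact ⟨h1, fun j k => Or.inl (h2 j k)⟩
        · obtain ⟨h1, h2⟩ := halfDefined_facts h1
          exact ⟨h1, fun j k => Or.inr (h2 j k)⟩
    have hone : ∀ t, i ≤ t → t ≤ n → ∀ j, ∃ k, override f h (xV t j k) = true := by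
      intro t ht htn j
      refine ⟨true, ?_⟩
      rw [hx t j true htn (undef_above (by omega) htn j true).1]
      simp [ht]
    apply sep_matrix
    · intro j k
      exact override_some h (h0 j k)
    · exact hone n hi2 le_rfl
    · intro t j ht htn
      rcases Nat.lt_or_ge i t with h1 | h1
      · exact Or.inr (hone (t - 1) (by omega) (by omega) j)
      · left
        by_cases hL : t ≤ maxLevel n f
        · obtain ⟨⟨c, hc⟩, -⟩ := hlow t ht hL
          exact ⟨c, fun k => override_some h (hc k)⟩
        · refine ⟨!(Y h), fun k => ?_⟩
          rw [hx' t _ k ht htn (undef_above (by omega) htn _ k).2]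
          have h2 : ¬ i < t := by omega
          simp [h2]
    · intro t j k ht htn hxt hyt
      by_cases hL : t ≤ maxLevel n f
      · rcases (hlow t ht hL).2 j k with ⟨b, hb1, hb2⟩ | hn
        · rw [override_some h hb1] at hxt
          rw [override_some h hb2, hxt]
        · rw [hx t j k htn hn] at hxt
          have h2 : ¬ i ≤ t := by omega
          simp [h2] at hxt
      · obtain ⟨u1, u2⟩ := undef_above (by omega : maxLevel n f < t) htn j k
        rw [hx t j k htn u1] at hxt
        simp only [Bool.and_eq_true, decide_eq_true_eq] at hxt
        rw [hx' t j k ht htn u2]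
        rcases Nat.lt_or_ge i t with h1 | h1
        · simp [h1, hxt.2]
        · obtain rfl : t = i := by omega
          rw [hyi] at hyt
          simp [hyt, hxt.2]

/-- In a `Π_d` relaxation, some level above the maximum level is known. -/
theorem exists_known {d n : ℕ} {f : PA} (hd : 2 ≤ d) (P' : List (Quant × ℕ))
    (hrel : IsRelaxationPfx (instPrefix (sepPrefix n) f) P') (hnd : (P'.map Prod.snd).Nodup)
    (hpi : isPiPrefix d P') (hL : d ≤ 2 * (n - maxLevel n f)) :
    ∃ i, maxLevel n f < i ∧ i ≤ n ∧
      ((Quant.all, yV i) ∈ P' → ∀ j k, preceq P' (yV i) (xV' i j k)) := by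
  by_contra hcon
  push Not at hcon
  obtain ⟨hperm, hrel⟩ := hrel
  obtain ⟨β, hmono, hβ⟩ := exists_blockNumber _ _ _ hpi
  have hβall : ∀ a y, P'[a]? = some (Quant.all, y) → β a < d ∧ β a % 2 = 0 := by
    intro a y ha
    have := hβ a Quant.all (by simp [ha])
    simpa using this
  have hβex : ∀ a x, P'[a]? = some (Quant.ex, x) → β a % 2 = 1 := by
    intro a y ha
    have := hβ a Quant.ex (by simp [ha])
    simpa using this.2
  have main : ∀ t, maxLevel n f + (t + 1) ≤ n →
      ∃ a, P'[a]? = some (Quant.all, yV (maxLevel n f + (t + 1))) ∧ 2 * (t + 1) ≤ β a := by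
    intro t
    induction t with
    | zero =>
      intro ht
      obtain ⟨hy, j, k, hp⟩ := hcon _ (by omega : maxLevel n f < maxLevel n f + (0 + 1)) ht
      have hxm := hperm.mem_iff.1 (mem_inst_ex (mem_sep_x' n _ (by omega) ht j k)
        (undef_above (by omega) ht j k).2)
      obtain ⟨a, ha⟩ := List.mem_iff_getElem?.1 hy
      obtain ⟨b, hb⟩ := List.mem_iff_getElem?.1 hxm
      have hlt := index_lt_of_not_preceq ha hb hp
      have h1 := hmono hlt.le
      have h2 := hβall a _ ha
      have h3 := hβex b _ hb
      exact ⟨a, ha, by omega⟩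
    | succ t ih =>
      intro ht
      obtain ⟨a0, ha0, hβ0⟩ := ih (by omega)
      obtain ⟨hy, j, k, hp⟩ := hcon _ (by omega : maxLevel n f < maxLevel n f + (t + 1 + 1)) ht
      have hfx := (undef_above (by omega : maxLevel n f < maxLevel n f + (t + 1 + 1)) ht j k).2
      have hxi := mem_inst_ex (mem_sep_x' n _ (by omega) ht j k) hfx
      have hxm := hperm.mem_iff.1 hxi
      obtain ⟨a, ha⟩ := List.mem_iff_getElem?.1 hy
      obtain ⟨b, hb⟩ := List.mem_iff_getElem?.1 hxm
      have hlt := index_lt_of_not_preceq ha hb hp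
      have hyi := hperm.mem_iff.2 (List.mem_of_getElem? ha0)
      have hpre : preceq (instPrefix (sepPrefix n) f) (yV (maxLevel n f + (t + 1)))
          (xV' (maxLevel n f + (t + 1) + 1) j k) := by
        apply preceq_of_sublist
        rw [instPrefix_vars]
        have hs := (sublist_sep n (maxLevel n f + (t + 1)) (by omega) (by omega) j k).filter
          (fun v => (f v).isNone)
        have hfx2 : f (xV' (maxLevel n f + (t + 1) + 1) j k) = none := hfx
        rw [List.filter_cons, List.filter_cons] at hs
        simpa [mem_inst_none hyi, hfx2] using hs
      have hpre' := hrel _ (by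
          unfold univVars
          exact List.mem_map.2 ⟨_, List.mem_filter.2 ⟨hyi, by simp⟩, rfl⟩) _ (by
          unfold existVars
          exact List.mem_map.2 ⟨_, List.mem_filter.2 ⟨hxi, by simp⟩, rfl⟩) hpre
      have hlt2 := index_lt_of_preceq hnd ha0 hb hpre'
      have h1 := hmono hlt.le
      have h1' := hmono hlt2.le
      have h2 := hβall a _ ha
      have h2' := hβall a0 _ ha0
      have h3 := hβex b _ hb
      exact ⟨a, ha, by omega⟩
  obtain ⟨a, ha, hβa⟩ := main (n - maxLevel n f - 1) (by omega)
  have := (hβall a _ ha).1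
  omega

/-- Lemma 6.5: for `2 ≤ d ≤ 2n`, every assignment
`f ∈ Fₙ ∩ H(Φₙ, Π_d)` has `sₙ(f) > n − ⌈d/2⌉`. -/
theorem sep_many_points (d n : ℕ) (hd : 2 ≤ d) (hdn : d ≤ 2 * n) :
    ∀ f ∈ Fset n ∩ Hset (sepQBC n) d, n - (d + 1) / 2 < score n f := by
  rintro f ⟨hF, -, Φ', ⟨hrel, hmat⟩, hpi, hfalse⟩
  have hrel' : IsRelaxationPfx (instPrefix (sepPrefix n) f) Φ'.pfx := hrel
  have hnd : (Φ'.pfx.map Prod.snd).Nodup := by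
    rw [← (hrel'.1.map Prod.snd).nodup_iff, instPrefix_vars]
    exact (sepPrefix_nodup n).filter _
  have hfun : ∀ m, ¬ FunnyAssign n f m := by
    intro m hm
    apply hfalse
    intro g
    rw [hmat]
    exact funny_true hm Φ'.pfx hrel'.1 hnd g
  have hs : score n f = maxLevel n f := by
    unfold score
    rw [dif_neg]
    rintro ⟨m, hm⟩
    exact hfun m hm
  rw [hs]
  by_contra hc
  have hN : NormalAssign n f := by
    rcases hF with h | ⟨m, hm⟩
    · exact h
    · exact absurd hm (hfun m)
  obtain ⟨i, hi1, hi2, hk⟩ := exists_known hd Φ'.pfx hrel' hnd hpi (by omega)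
  apply hfalse
  intro g
  rw [hmat]
  exact normal_true hN Φ'.pfx hrel'.1 hnd hi1 hi2 hk g
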